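/- Let {(i₁,j₁),…,(i_{n−1},j_{n−1})} be the edge set of a directed tree on the vertex set {1,…,n}. Then the indicator function of the simplicial cone ⟨e_{i₁}−e_{j₁},…,e_{i_{n−1}}−e_{j_{n−1}}⟩₊ ⊆ V₀ⁿ equals ∑_π (−1)^{n−len(π)} [[π]], where π ranges over all ordered set partitions of {1,…,n} such that for every a = 1,…,n−1 the block containing i_a strictly precedes the block containing j_a. -/

import Mathlib

open scoped Pointwise Classical

namespace PlatesPaper

/-- The union of a list of finite sets. -/
def lUnion {n : ℕ} (L : List (Finset (Fin n))) : Finset (Fin n) :=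
  L.foldr (· ∪ ·) ∅

/-- `L` is an ordered set partition of `J`: a list of pairwise disjoint nonempty
finite sets whose union is `J`. -/
def IsOSP {n : ℕ} (J : Finset (Fin n)) (L : List (Finset (Fin n))) : Prop :=
  (∀ B ∈ L, B.Nonempty) ∧ L.Pairwise Disjoint ∧ lUnion L = J

/-- The plate of an ordered set partition `L` (of a subset `J = lUnion L` of `{1,…,n}`):
the set of `x ∈ V₀ⁿ` vanishing outside `J`, with `x_J = 0`, and such that the partial
sums over the unions of the first `i` blocks are nonnegative for `i = 1,…,len(L)−1`.
(For an ordered set partition of the whole of `{1,…,n}` the first two conditions are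
equivalent to `x ∈ V₀ⁿ`.) -/
def plate {n : ℕ} (L : List (Finset (Fin n))) : Set (Fin n → ℝ) :=
  {x | (∑ i, x i = 0) ∧ (∀ j, j ∉ lUnion L → x j = 0) ∧ (∑ j ∈ lUnion L, x j = 0) ∧
    ∀ i : ℕ, 0 < i → i < L.length → 0 ≤ ∑ j ∈ lUnion (L.take i), x j}

/-- `ℚ`-valued indicator function of a set of points of `ℝⁿ`. -/
noncomputable def ind {n : ℕ} (S : Set (Fin n → ℝ)) : (Fin n → ℝ) → ℚ :=
  fun x => if x ∈ S then 1 else 0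

/-- The index of the block of `L` containing the element `a`. -/
def blockIdx {n : ℕ} (L : List (Finset (Fin n))) (a : Fin n) : ℕ :=
  L.findIdx fun B => decide (a ∈ B)

/-- The index of the block of `L` containing the set `B`. -/
def subIdx {n : ℕ} (L : List (Finset (Fin n))) (B : Finset (Fin n)) : ℕ :=
  L.findIdx fun C => decide (B ⊆ C)

/-- `B` is contained in one of the blocks of `L`. -/
def memBlock {n : ℕ} (L : List (Finset (Fin n))) (B : Finset (Fin n)) : Prop :=
  ∃ j < L.length, B ⊆ L.getD j ∅

/-- The root vector `e_{p.1} − e_{p.2}` of `ℝⁿ`. -/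
def rootVec (n : ℕ) (p : Fin n × Fin n) : Fin n → ℝ :=
  fun i => (if i = p.1 then 1 else 0) - (if i = p.2 then 1 else 0)

/-- The conical hull `⟨e_{i₁}−e_{j₁},…,e_{i_{n−1}}−e_{j_{n−1}}⟩₊`. -/
def treeCone (n : ℕ) (e : Fin (n - 1) → Fin n × Fin n) : Set (Fin n → ℝ) :=
  {x | ∃ c : Fin (n - 1) → ℝ, (∀ a, 0 ≤ c a) ∧ x = ∑ a, c a • rootVec n (e a)}

/-- The `n − 1` ordered pairs `e a` are the edges of a directed tree on `{1,…,n}`: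
the endpoints of each pair are distinct and the underlying undirected graph is a
tree (hence spanning). -/
def IsDirTree (n : ℕ) (e : Fin (n - 1) → Fin n × Fin n) : Prop :=
  (∀ a, (e a).1 ≠ (e a).2) ∧
  (SimpleGraph.fromRel fun u v => ∃ a, e a = (u, v)).IsTree

section Helpers

/-- Compatibility of a list of blocks with a relation on `U`. -/
def Compat {n : ℕ} (R : Fin n → Fin n → Prop) (U : Finset (Fin n))
    (L : List (Finset (Fin n))) : Prop :=
  ∀ u ∈ U, ∀ v ∈ U, R u v → blockIdx L u < blockIdx L v

/-- The compatible ordered set partitions of `U`. -/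
def compOSP {n : ℕ} (R : Fin n → Fin n → Prop) (U : Finset (Fin n)) :
    Set (List (Finset (Fin n))) := {L | IsOSP U L ∧ Compat R U L}

/-- All suffix sums are nonnegative. -/
def Good {n : ℕ} (y : Fin n → ℝ) (L : List (Finset (Fin n))) : Prop :=
  ∀ i : ℕ, 0 ≤ ∑ j ∈ lUnion (L.drop i), y j

/-- `J` is an up-set of `U`. -/
def IsUp {n : ℕ} (R : Fin n → Fin n → Prop) (U J : Finset (Fin n)) : Prop :=
  J ⊆ U ∧ ∀ u ∈ J, ∀ v ∈ U, R u v → v ∈ J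

/-- All up-sets have nonnegative sum. -/
def UpPos {n : ℕ} (R : Fin n → Fin n → Prop) (y : Fin n → ℝ) (U : Finset (Fin n)) : Prop :=
  ∀ J, IsUp R U J → 0 ≤ ∑ j ∈ J, y j

/-- Minimal elements of `U`. -/
noncomputable def minEl {n : ℕ} (R : Fin n → Fin n → Prop) (U : Finset (Fin n)) :
    Finset (Fin n) := U.filter fun u => ∀ v ∈ U, ¬ R v u

theorem lUnion_cons {n : ℕ} (B : Finset (Fin n)) (L : List (Finset (Fin n))) :
    lUnion (B :: L) = B ∪ lUnion L := rfl

theorem lUnion_nil {n : ℕ} : lUnion ([] : List (Finset (Fin n))) = ∅ := rfl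

theorem mem_lUnion {n : ℕ} (L : List (Finset (Fin n))) (a : Fin n) :
    a ∈ lUnion L ↔ ∃ B ∈ L, a ∈ B := by
  induction L with
  | nil => simp [lUnion_nil]
  | cons B L ih => simp [lUnion_cons, ih]

theorem lUnion_append {n : ℕ} (L M : List (Finset (Fin n))) :
    lUnion (L ++ M) = lUnion L ∪ lUnion M := by
  ext a
  simp only [mem_lUnion, Finset.mem_union, List.mem_append]
  grind

theorem disjoint_lUnion {n : ℕ} (B : Finset (Fin n)) (L : List (Finset (Fin n)))
    (h : ∀ C ∈ L, Disjoint B C) : Disjoint B (lUnion L) := by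
  rw [Finset.disjoint_left]
  intro a ha hb
  obtain ⟨C, hC, haC⟩ := (mem_lUnion L a).1 hb
  exact Finset.disjoint_left.1 (h C hC) ha haC

theorem isOSP_cons {n : ℕ} (U B : Finset (Fin n)) (L : List (Finset (Fin n))) :
    IsOSP U (B :: L) ↔ B.Nonempty ∧ B ⊆ U ∧ IsOSP (U \ B) L := by
  unfold IsOSP
  rw [lUnion_cons, List.pairwise_cons, List.forall_mem_cons]
  constructor
  · rintro ⟨⟨hB, h1⟩, ⟨h2, h3⟩, h4⟩
    have hd := disjoint_lUnion B L h2
    refine ⟨hB, ?_, h1, h3, ?_⟩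
    · rw [← h4]; exact Finset.subset_union_left
    · rw [← h4, Finset.union_sdiff_cancel_left hd]
  · rintro ⟨hB, hU, h1, h3, h4⟩
    refine ⟨⟨hB, h1⟩, ⟨?_, h3⟩, ?_⟩
    · intro C hC
      rw [Finset.disjoint_left]
      intro a ha haC
      have : a ∈ U \ B := by rw [← h4]; exact (mem_lUnion L a).2 ⟨C, hC, haC⟩
      exact (Finset.mem_sdiff.1 this).2 ha
    · rw [h4]; exact Finset.union_sdiff_of_subset hU

theorem blockIdx_cons {n : ℕ} (B : Finset (Fin n)) (L : List (Finset (Fin n))) (a : Fin n) :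
    blockIdx (B :: L) a = if a ∈ B then 0 else blockIdx L a + 1 := by
  unfold blockIdx
  rw [List.findIdx_cons]
  by_cases h : a ∈ B <;> simp [h]

theorem compOSP_cons {n : ℕ} (R : Fin n → Fin n → Prop) (U B : Finset (Fin n))
    (L : List (Finset (Fin n))) :
    B :: L ∈ compOSP R U ↔ B.Nonempty ∧ B ⊆ minEl R U ∧ L ∈ compOSP R (U \ B) := by
  simp only [compOSP, Set.mem_ofPred_eq, isOSP_cons, Compat, blockIdx_cons]
  constructor
  · rintro ⟨⟨h1, h2, h3⟩, h4⟩
    refine ⟨h1, ?_, h3, ?_⟩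
    · intro u hu
      refine Finset.mem_filter.2 ⟨h2 hu, fun v hv hR => ?_⟩
      have := h4 v hv u (h2 hu) hR
      simp [hu] at this
    · intro u hu v hv hR
      rw [Finset.mem_sdiff] at hu hv
      have := h4 u hu.1 v hv.1 hR
      simpa [hu.2, hv.2] using this
  · rintro ⟨h1, h2, h3, h4⟩
    refine ⟨⟨h1, h2.trans (Finset.filter_subset _ _), h3⟩, ?_⟩
    intro u hu v hv hR
    have hvB : v ∉ B := fun h => (Finset.mem_filter.1 (h2 h)).2 u hu hR
    by_cases huB : u ∈ B
    · simp [huB, hvB]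
    · simpa [huB, hvB] using
        h4 u (Finset.mem_sdiff.2 ⟨hu, huB⟩) v (Finset.mem_sdiff.2 ⟨hv, hvB⟩) hR

theorem good_cons {n : ℕ} (y : Fin n → ℝ) (U B : Finset (Fin n)) (L : List (Finset (Fin n)))
    (h : lUnion (B :: L) = U) : Good y (B :: L) ↔ 0 ≤ ∑ j ∈ U, y j ∧ Good y L := by
  constructor
  · intro hg
    exact ⟨by simpa [h] using hg 0, fun i => by simpa using hg (i + 1)⟩
  · rintro ⟨h0, hg⟩ i
    cases i with
    | zero => simpa [h] using h0
    | succ i => simpa using hg i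

theorem toggle {n : ℕ} (R : Fin n → Fin n → Prop) (ψ : Fin n → ℕ)
    (hψ : ∀ u v, R u v → ψ v < ψ u) (y : Fin n → ℝ) (U : Finset (Fin n)) (hU : U.Nonempty)
    (hy : 0 ≤ ∑ j ∈ U, y j) :
    ∃ m ∈ minEl R U, ∀ B ⊆ minEl R U, (UpPos R y (U \ insert m B) ↔ UpPos R y (U \ B)) := by
  obtain ⟨J₀, hJ₀, hne, hmin⟩ : ∃ J₀, IsUp R U J₀ ∧ J₀ ≠ U ∧
      ∀ J, IsUp R U J → ∑ j ∈ J₀, y j ≤ ∑ j ∈ J, y j := by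
    have hemp : IsUp R U ∅ := ⟨by simp, by simp⟩
    obtain ⟨J, hJ, hm⟩ := Finset.exists_min_image (U.powerset.filter fun J => IsUp R U J)
      (fun J => ∑ j ∈ J, y j) ⟨∅, by simp [hemp]⟩
    have hm' : ∀ K, IsUp R U K → ∑ j ∈ J, y j ≤ ∑ j ∈ K, y j := fun K hK =>
      hm K (Finset.mem_filter.2 ⟨Finset.mem_powerset.2 hK.1, hK⟩)
    by_cases hJU : J = U
    · refine ⟨∅, hemp, hU.ne_empty.symm, fun K hK => ?_⟩
      rw [Finset.sum_empty]
      exact (hJU ▸ hy : 0 ≤ ∑ j ∈ J, y j).trans (hm' K hK)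
    · exact ⟨J, (Finset.mem_filter.1 hJ).2, hJU, hm'⟩
  have hne' : (U \ J₀).Nonempty := by
    rw [Finset.sdiff_nonempty]
    exact fun h => hne (Finset.Subset.antisymm hJ₀.1 h)
  obtain ⟨m, hm, hmax⟩ := Finset.exists_max_image (U \ J₀) ψ hne'
  rw [Finset.mem_sdiff] at hm
  have hmM : m ∈ minEl R U := by
    refine Finset.mem_filter.2 ⟨hm.1, fun v hv hR => ?_⟩
    by_cases hvJ : v ∈ J₀
    · exact hm.2 (hJ₀.2 v hvJ m hm.1 hR)
    · have := hmax v (Finset.mem_sdiff.2 ⟨hv, hvJ⟩)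
      have := hψ v m hR
      omega
  have up : ∀ B ⊆ minEl R U, ∀ J, IsUp R (U \ B) J → IsUp R U J := by
    intro B hB J hJ
    refine ⟨hJ.1.trans Finset.sdiff_subset, fun u hu v hv hR => ?_⟩
    refine hJ.2 u hu v (Finset.mem_sdiff.2 ⟨hv, fun hvB => ?_⟩) hR
    exact (Finset.mem_filter.1 (hB hvB)).2 u (Finset.mem_sdiff.1 (hJ.1 hu)).1 hR
  refine ⟨m, hmM, fun B hB => ⟨fun h J hJ => ?_, fun h J hJ => ?_⟩⟩
  · have hJU := up B hB J hJ
    have h1 : IsUp R (U \ insert m B) (J ∩ J₀) := by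
      refine ⟨fun u hu => ?_, fun u hu v hv hR => ?_⟩
      · rw [Finset.mem_inter] at hu
        have := Finset.mem_sdiff.1 (hJ.1 hu.1)
        refine Finset.mem_sdiff.2 ⟨this.1, fun h' => ?_⟩
        rcases Finset.mem_insert.1 h' with h' | h'
        · exact hm.2 (h' ▸ hu.2)
        · exact this.2 h'
      · rw [Finset.mem_inter] at hu ⊢
        have hv' := (Finset.mem_sdiff.1 hv).1
        exact ⟨hJU.2 u hu.1 v hv' hR, hJ₀.2 u hu.2 v hv' hR⟩
    have h2 : IsUp R U (J ∪ J₀) := by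
      refine ⟨Finset.union_subset hJU.1 hJ₀.1, fun u hu v hv hR => ?_⟩
      rw [Finset.mem_union] at hu ⊢
      exact hu.imp (fun h => hJU.2 u h v hv hR) (fun h => hJ₀.2 u h v hv hR)
    have h3 := Finset.sum_union_inter (s₁ := J) (s₂ := J₀) (f := y)
    have h4 := h _ h1
    have h5 := hmin _ h2
    linarith
  · apply h
    have hJU := up (insert m B) (Finset.insert_subset hmM hB) J hJ
    refine ⟨hJ.1.trans (Finset.sdiff_subset_sdiff le_rfl (Finset.subset_insert _ _)), ?_⟩
    exact fun u hu v hv hR => hJU.2 u hu v (Finset.mem_sdiff.1 hv).1 hR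

theorem alt_sum {n : ℕ} (R : Fin n → Fin n → Prop) (ψ : Fin n → ℕ)
    (hψ : ∀ u v, R u v → ψ v < ψ u) (y : Fin n → ℝ) (U : Finset (Fin n)) (hU : U.Nonempty)
    (hy : 0 ≤ ∑ j ∈ U, y j) :
    ∑ B ∈ (minEl R U).powerset, (-1 : ℚ) ^ B.card * (if UpPos R y (U \ B) then 1 else 0) = 0 := by
  obtain ⟨m, hm, ht⟩ := toggle R ψ hψ y U hU hy
  rw [← Finset.insert_erase hm, Finset.sum_powerset_insert (Finset.notMem_erase _ _),
    ← Finset.sum_add_distrib]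
  apply Finset.sum_eq_zero
  intro B hB
  rw [Finset.mem_powerset] at hB
  have hmB : m ∉ B := fun h => Finset.notMem_erase _ _ (hB h)
  rw [Finset.card_insert_of_notMem hmB]
  simp only [ht B (hB.trans (Finset.erase_subset _ _))]
  ring

theorem compOSP_eq {n : ℕ} (R : Fin n → Fin n → Prop) (U : Finset (Fin n)) (hU : U.Nonempty) :
    compOSP R U = ⋃ B ∈ ((((minEl R U).powerset.erase ∅ : Finset (Finset (Fin n)))) :
      Set (Finset (Fin n))), (List.cons B) '' compOSP R (U \ B) := by
  ext L
  simp only [Set.mem_iUnion, Finset.mem_coe, Finset.mem_erase, Finset.mem_powerset, exists_prop]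
  cases L with
  | nil =>
    constructor
    · rintro ⟨⟨_, _, h⟩, _⟩
      exact absurd h.symm hU.ne_empty
    · rintro ⟨B, _, L, _, h⟩
      simp at h
  | cons B L =>
    rw [compOSP_cons]
    constructor
    · rintro ⟨h1, h2, h3⟩
      exact ⟨B, ⟨h1.ne_empty, h2⟩, L, h3, rfl⟩
    · rintro ⟨B', ⟨h1, h2⟩, L', h3, h⟩
      obtain ⟨rfl, rfl⟩ := List.cons.inj h
      exact ⟨Finset.nonempty_iff_ne_empty.2 h1, h2, h3⟩

theorem key {n : ℕ} (R : Fin n → Fin n → Prop) (ψ : Fin n → ℕ)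
    (hψ : ∀ u v, R u v → ψ v < ψ u) (y : Fin n → ℝ) :
    ∀ (k : ℕ) (U : Finset (Fin n)), U.card = k → (compOSP R U).Finite ∧
      ∑ᶠ L ∈ compOSP R U, (-1 : ℚ) ^ L.length * (if Good y L then 1 else 0) =
        (-1) ^ U.card * (if UpPos R y U then 1 else 0) := by
  intro k
  induction k using Nat.strong_induction_on with
  | _ k ih =>
  intro U hk
  rcases U.eq_empty_or_nonempty with rfl | hU
  · have h0 : compOSP R (∅ : Finset (Fin n)) = {[]} := by
      ext L
      rw [Set.mem_singleton_iff]
      constructor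
      · intro h
        cases L with
        | nil => rfl
        | cons B L =>
          have := (isOSP_cons _ _ _).1 h.1
          exact absurd (Finset.subset_empty.1 this.2.1) this.1.ne_empty
      · rintro rfl
        exact ⟨⟨by simp, by simp, rfl⟩, by intro u hu; simp at hu⟩
    rw [h0]
    refine ⟨Set.finite_singleton _, ?_⟩
    rw [finsum_mem_singleton]
    have h1 : Good y ([] : List (Finset (Fin n))) := by intro i; simp [lUnion_nil]
    have h2 : UpPos R y ∅ := by
      intro J hJ
      rw [Finset.subset_empty.1 hJ.1]; simp
    simp [h1, h2]
  · set T := (minEl R U).powerset.erase ∅ with hT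
    have hTp : ∀ B ∈ T, B.Nonempty ∧ B ⊆ minEl R U ∧ B ⊆ U := by
      intro B hB
      rw [hT, Finset.mem_erase, Finset.mem_powerset] at hB
      exact ⟨Finset.nonempty_iff_ne_empty.2 hB.1, hB.2, hB.2.trans (Finset.filter_subset _ _)⟩
    have hlt : ∀ B ∈ T, (U \ B).card < k := by
      intro B hB
      rw [← hk]
      obtain ⟨h1, _, h3⟩ := hTp B hB
      exact Finset.card_lt_card (Finset.sdiff_ssubset h3 h1)
    have hfin : ∀ B ∈ T, ((List.cons B) '' compOSP R (U \ B)).Finite := fun B hB =>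
      (ih _ (hlt B hB) _ rfl).1.image _
    rw [compOSP_eq R U hU]
    refine ⟨T.finite_toSet.biUnion hfin, ?_⟩
    rw [finsum_mem_biUnion ?_ T.finite_toSet hfin, finsum_mem_coe_finset]
    · have hB : ∀ B ∈ T, ∑ᶠ L ∈ (List.cons B) '' compOSP R (U \ B),
          (-1 : ℚ) ^ L.length * (if Good y L then 1 else 0) =
          -(if 0 ≤ ∑ j ∈ U, y j then 1 else 0) * (-1) ^ U.card *
            ((-1) ^ B.card * (if UpPos R y (U \ B) then 1 else 0)) := by
        intro B hB
        rw [finsum_mem_image (fun a _ b _ h => (List.cons.inj h).2)]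
        have h1 : ∀ L ∈ compOSP R (U \ B),
            (-1 : ℚ) ^ (B :: L).length * (if Good y (B :: L) then 1 else 0) =
            -(if 0 ≤ ∑ j ∈ U, y j then 1 else 0) *
              ((-1 : ℚ) ^ L.length * (if Good y L then 1 else 0)) := by
          intro L hL
          have := (good_cons y U B L (by
            rw [lUnion_cons, hL.1.2.2]; exact Finset.union_sdiff_of_subset (hTp B hB).2.2))
          simp only [this, List.length_cons, pow_succ]
          by_cases ha : 0 ≤ ∑ j ∈ U, y j <;> by_cases hb : Good y L <;> simp [ha, hb]
        rw [finsum_mem_congr rfl h1, ← mul_finsum_mem' _ _ (ih _ (hlt B hB) _ rfl).1,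
          (ih _ (hlt B hB) _ rfl).2]
        have hc := Finset.card_sdiff_add_card_eq_card (hTp B hB).2.2
        rw [← hc, pow_add]
        have : ((-1 : ℚ) ^ B.card) * (-1) ^ B.card = 1 := by
          rw [← mul_pow]; simp
        linear_combination (-(-(if 0 ≤ ∑ j ∈ U, y j then (1 : ℚ) else 0) *
          (-1) ^ (U \ B).card * (if UpPos R y (U \ B) then 1 else 0))) * this
      rw [Finset.sum_congr rfl hB, ← Finset.mul_sum]
      by_cases hy : 0 ≤ ∑ j ∈ U, y j
      · have h := alt_sum R ψ hψ y U hU hy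
        rw [← Finset.add_sum_erase _ _ (Finset.empty_mem_powerset _)] at h
        simp only [Finset.card_empty, pow_zero, Finset.sdiff_empty, one_mul] at h
        rw [← hT] at h
        rw [if_pos hy]
        linear_combination (-(-1 : ℚ) ^ U.card) * h
      · have : ¬ UpPos R y U := fun h => hy (h U ⟨le_rfl, fun _ _ v hv _ => hv⟩)
        simp [hy, this]
    · intro B _ C _ hBC
      rw [Function.onFun, Set.disjoint_left]
      rintro _ ⟨L, _, rfl⟩ ⟨M, _, h⟩
      exact hBC (List.cons.inj h).1.symm

theorem isOSP_length {n : ℕ} (L : List (Finset (Fin n))) :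
    ∀ U : Finset (Fin n), IsOSP U L → L.length ≤ U.card := by
  induction L with
  | nil => intro U _; simp
  | cons B L ih =>
    intro U h
    obtain ⟨h1, h2, h3⟩ := (isOSP_cons _ _ _).1 h
    have := ih _ h3
    have := Finset.card_sdiff_add_card_eq_card h2
    have := h1.card_pos
    simp only [List.length_cons]
    omega

theorem plate_iff {n : ℕ} (x : Fin n → ℝ) (hx : ∑ i, x i = 0) (L : List (Finset (Fin n)))
    (hL : IsOSP Finset.univ L) : x ∈ plate L ↔ Good (fun i => - x i) L := by
  have hsplit : ∀ i, ∑ j ∈ lUnion (L.take i), x j + ∑ j ∈ lUnion (L.drop i), x j = 0 := by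
    intro i
    rw [← Finset.sum_union, ← lUnion_append, List.take_append_drop, hL.2.2, hx]
    rw [Finset.disjoint_left]
    intro a ha hb
    obtain ⟨B, hB, haB⟩ := (mem_lUnion _ _).1 ha
    obtain ⟨C, hC, haC⟩ := (mem_lUnion _ _).1 hb
    have hp := hL.2.1
    rw [← List.take_append_drop i L, List.pairwise_append] at hp
    exact Finset.disjoint_left.1 (hp.2.2 B hB C hC) haB haC
  simp only [plate, Set.mem_ofPred_eq, Good, Finset.sum_neg_distrib, hL.2.2]
  constructor
  · rintro ⟨_, _, _, h⟩ i
    by_cases h0 : 0 < i ∧ i < L.length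
    · have := h i h0.1 h0.2
      have := hsplit i
      linarith
    · rcases Nat.eq_zero_or_pos i with rfl | hi
      · simp [hL.2.2, hx]
      · rw [List.drop_eq_nil_of_le (by omega)]; simp [lUnion_nil]
  · intro h
    refine ⟨hx, by simp, hx, fun i _ _ => ?_⟩
    have := h i
    have := hsplit i
    linarith

theorem exists_cuts (n : ℕ) (e : Fin (n - 1) → Fin n × Fin n) (he : IsDirTree n e) :
    ∃ S : Fin (n - 1) → Finset (Fin n), ∀ a, (e a).1 ∈ S a ∧ (e a).2 ∉ S a ∧
      ∀ b, b ≠ a → ((e b).1 ∈ S a ↔ (e b).2 ∈ S a) := by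
  obtain ⟨hne, ht⟩ := he
  set G := SimpleGraph.fromRel fun u v => ∃ a, e a = (u, v) with hG
  have hadj : ∀ a, G.Adj (e a).1 (e a).2 := by
    intro a
    rw [hG, SimpleGraph.fromRel_adj]
    exact ⟨hne a, Or.inl ⟨a, rfl⟩⟩
  let f : Fin (n - 1) → G.edgeSet := fun a => ⟨s((e a).1, (e a).2), hadj a⟩
  have hsurj : Function.Surjective f := by
    rintro ⟨p, hp⟩
    induction p using Sym2.ind with
    | _ u v =>
    have hp' : G.Adj u v := hp
    rw [hG, SimpleGraph.fromRel_adj] at hp'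
    rcases hp'.2 with ⟨a, ha⟩ | ⟨a, ha⟩
    · exact ⟨a, Subtype.ext (by simp [f, ha])⟩
    · exact ⟨a, Subtype.ext (by simp [f, ha, Sym2.eq_swap])⟩
  have hcard : Fintype.card (Fin (n - 1)) = Fintype.card G.edgeSet := by
    have := ht.card_edgeFinset
    rw [← SimpleGraph.edgeFinset_card]
    simp only [Fintype.card_fin] at this ⊢
    omega
  have hinj : Function.Injective f :=
    ((Fintype.bijective_iff_surjective_and_card f).2 ⟨hsurj, hcard⟩).1
  refine ⟨fun a => Finset.univ.filter fun v =>
    (G.deleteEdges {s((e a).1, (e a).2)}).Reachable (e a).1 v, fun a => ?_⟩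
  simp only [Finset.mem_filter, Finset.mem_univ, true_and]
  have hbr := SimpleGraph.isAcyclic_iff_forall_isBridge.1 ht.2 (e:= s((e a).1, (e a).2)) (hadj a)
  refine ⟨SimpleGraph.Reachable.refl _, ?_, ?_⟩
  · rw [SimpleGraph.isBridge_iff] at hbr
    simpa using hbr
  · intro b hb
    have hab : (G.deleteEdges {s((e a).1, (e a).2)}).Adj (e b).1 (e b).2 := by
      rw [SimpleGraph.deleteEdges_adj]
      refine ⟨hadj b, fun h => hb (hinj (Subtype.ext ?_))⟩
      exact h
    exact ⟨fun h => h.trans hab.reachable, fun h => h.trans hab.symm.reachable⟩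

theorem sum_rootVec {n : ℕ} (p : Fin n × Fin n) (J : Finset (Fin n)) :
    ∑ i ∈ J, rootVec n p i = (if p.1 ∈ J then 1 else 0) - (if p.2 ∈ J then 1 else 0) := by
  simp [rootVec, Finset.sum_sub_distrib]

theorem sum_comb {n : ℕ} (e : Fin (n - 1) → Fin n × Fin n) (c : Fin (n - 1) → ℝ)
    (J : Finset (Fin n)) : ∑ i ∈ J, (∑ a, c a • rootVec n (e a)) i =
      ∑ a, c a * ((if (e a).1 ∈ J then 1 else 0) - (if (e a).2 ∈ J then 1 else 0)) := by
  simp only [Finset.sum_apply, Pi.smul_apply, smul_eq_mul]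
  rw [Finset.sum_comm]
  simp only [← Finset.mul_sum, sum_rootVec]

theorem span_roots (n : ℕ) (e : Fin (n - 1) → Fin n × Fin n) (he : IsDirTree n e)
    (x : Fin n → ℝ) (hx : ∑ i, x i = 0) :
    ∃ c : Fin (n - 1) → ℝ, ∑ a, c a • rootVec n (e a) = x := by
  rw [← Submodule.mem_span_range_iff_exists_fun ℝ]
  set W := Submodule.span ℝ (Set.range fun a => rootVec n (e a)) with hW
  obtain ⟨hne, ht⟩ := he
  have hwalk : ∀ u v, (SimpleGraph.fromRel fun u v => ∃ a, e a = (u, v)).Walk u v →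
      rootVec n (u, v) ∈ W := by
    intro u v p
    induction p with
    | nil =>
      convert W.zero_mem
      ext i; simp [rootVec]
    | @cons u v w h p ih =>
      have h1 : rootVec n (u, w) = rootVec n (u, v) + rootVec n (v, w) := by
        ext i; simp [rootVec]
      rw [h1]
      refine W.add_mem ?_ ih
      rw [SimpleGraph.fromRel_adj] at h
      rcases h.2 with ⟨a, ha⟩ | ⟨a, ha⟩
      · exact Submodule.subset_span ⟨a, by simp [ha]⟩
      · have h2 : rootVec n (u, v) = - rootVec n (v, u) := by
          ext i; simp [rootVec]
        rw [h2]
        exact W.neg_mem (Submodule.subset_span ⟨a, by simp [ha]⟩)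
  obtain ⟨v₀⟩ := ht.1.nonempty
  have hxs : x = ∑ u, x u • rootVec n (u, v₀) := by
    ext i
    simp only [Finset.sum_apply, Pi.smul_apply, smul_eq_mul, rootVec, mul_sub,
      Finset.sum_sub_distrib]
    simp [hx]
  rw [hxs]
  refine W.sum_mem fun u _ => W.smul_mem _ ?_
  obtain ⟨p⟩ := ht.1.preconnected u v₀
  exact hwalk u v₀ p

theorem cone_iff (n : ℕ) (e : Fin (n - 1) → Fin n × Fin n) (he : IsDirTree n e)
    (S : Fin (n - 1) → Finset (Fin n)) (hS : ∀ a, (e a).1 ∈ S a ∧ (e a).2 ∉ S a ∧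
      ∀ b, b ≠ a → ((e b).1 ∈ S a ↔ (e b).2 ∈ S a)) (x : Fin n → ℝ) (hx : ∑ i, x i = 0) :
    x ∈ treeCone n e ↔
      UpPos (fun u v => ∃ a, e a = (u, v)) (fun i => - x i) Finset.univ := by
  constructor
  · rintro ⟨c, hc, rfl⟩ J hJ
    rw [Finset.sum_neg_distrib, sum_comb, neg_nonneg]
    apply Finset.sum_nonpos
    intro a _
    apply mul_nonpos_of_nonneg_of_nonpos (hc a)
    by_cases h : (e a).1 ∈ J
    · simp [h, hJ.2 _ h (e a).2 (Finset.mem_univ _) ⟨a, rfl⟩]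
    · simp only [h, if_false]
      split_ifs <;> norm_num
  · intro h
    obtain ⟨c, hc⟩ := span_roots n e he x hx
    refine ⟨c, fun a => ?_, hc.symm⟩
    have h1 := h (S a)ᶜ ⟨Finset.subset_univ _, by
      rintro u hu v _ ⟨b, hb⟩
      rw [Finset.mem_compl] at hu ⊢
      by_cases hba : b = a
      · subst hba
        exact absurd (by simpa [hb] using (hS b).1) hu
      · have := (hS a).2.2 b hba
        rw [hb] at this
        exact fun hv => hu (this.2 hv)⟩
    have h2 := Finset.sum_add_sum_compl (S a) x
    have h3 : ∑ i ∈ S a, x i = c a := by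
      conv_lhs => rw [← hc]
      rw [sum_comb, Finset.sum_eq_single a]
      · simp [(hS a).1, (hS a).2.1]
      · intro b _ hb
        simp [(hS a).2.2 b hb]
      · simp
    rw [Finset.sum_neg_distrib] at h1
    linarith

end Helpers

/-- For a directed tree with edges `(i_a, j_a)` on `{1,…,n}`, the
indicator function of the simplicial cone `⟨e_{i_a} − e_{j_a}⟩₊` equals
`∑_π (−1)^{n − len(π)} [[π]]`, the sum being over all ordered set partitions `π` of
`{1,…,n}` such that for every edge the block containing `i_a` strictly precedes the
block containing `j_a`. -/
theorem statement_11 (n : ℕ) (e : Fin (n - 1) → Fin n × Fin n)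
    (he : IsDirTree n e) (x : Fin n → ℝ) (hx : ∑ i, x i = 0) :
    ind (treeCone n e) x =
    ∑ᶠ L ∈ {L : List (Finset (Fin n)) | IsOSP Finset.univ L ∧
        ∀ a : Fin (n - 1), blockIdx L (e a).1 < blockIdx L (e a).2},
      (-1 : ℚ) ^ (n - L.length) * ind (plate L) x := by
  obtain ⟨S, hS⟩ := exists_cuts n e he
  let R : Fin n → Fin n → Prop := fun u v => ∃ a, e a = (u, v)
  let ψ : Fin n → ℕ := fun v => ∑ a, if v ∈ S a then 1 else 0
  have hψ : ∀ u v, R u v → ψ v < ψ u := by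
    rintro u v ⟨b, hb⟩
    apply Finset.sum_lt_sum
    · intro a _
      by_cases hba : b = a
      · subst hba
        have := (hS b).2.1
        rw [hb] at this
        simp [this]
      · have := (hS a).2.2 b hba
        rw [hb] at this
        simp [this]
    · refine ⟨b, Finset.mem_univ _, ?_⟩
      have h1 := (hS b).1
      have h2 := (hS b).2.1
      rw [hb] at h1 h2
      simp [h1, h2]
  have hset : {L : List (Finset (Fin n)) | IsOSP Finset.univ L ∧
        ∀ a : Fin (n - 1), blockIdx L (e a).1 < blockIdx L (e a).2} =
      compOSP R Finset.univ := by
    ext L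
    simp only [compOSP, Set.mem_ofPred_eq, Compat]
    refine and_congr_right fun _ => ⟨?_, ?_⟩
    · rintro h u _ v _ ⟨a, ha⟩
      simpa [ha] using h a
    · intro h a
      exact h _ (Finset.mem_univ _) _ (Finset.mem_univ _) ⟨a, rfl⟩
  obtain ⟨hfin, hkey⟩ := key R ψ hψ (fun i => - x i) _ Finset.univ rfl
  have hterm : ∀ L ∈ compOSP R Finset.univ, (-1 : ℚ) ^ (n - L.length) * ind (plate L) x =
      (-1) ^ n * ((-1 : ℚ) ^ L.length * (if Good (fun i => - x i) L then 1 else 0)) := by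
    intro L hL
    have hlen := isOSP_length L _ hL.1
    rw [Finset.card_univ, Fintype.card_fin] at hlen
    have h1 : ((-1 : ℚ) ^ L.length) * (-1) ^ L.length = 1 := by
      rw [← mul_pow]; simp
    have h2 : (-1 : ℚ) ^ n = (-1) ^ (n - L.length) * (-1) ^ L.length := by
      rw [← pow_add, Nat.sub_add_cancel hlen]
    simp only [ind, plate_iff x hx L hL.1]
    rw [h2]
    linear_combination (-((-1 : ℚ) ^ (n - L.length) *
      (if Good (fun i => - x i) L then 1 else 0))) * h1
  rw [hset, finsum_mem_congr rfl hterm, ← mul_finsum_mem' _ _ hfin, hkey, ← mul_assoc,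
    Finset.card_univ, Fintype.card_fin, ← mul_pow]
  simp only [ind, cone_iff n e he S hS x hx]
  simp [R]

end PlatesPaper
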